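/- Let $\mathcal X$ be a measurable space, let $(X,Y)$ be a random pair in $\mathcal X\times\mathbb R$ with distribution $P$, and let $F_{Y|X=x}$ be the conditional cumulative distribution function of $Y$ given $X=x$ (for a fixed version of the regular conditional distribution). For measurable $g:\mathcal X\to\mathbb R$ and $p>0$ write $\|g\|_{L_p}=(\mathbb E|g(X)|^p)^{1/p}\in[0,\infty]$. Let $\delta>0$ and let $\ell_f(x,y)=(y-f(x))^2/2$ if $|y-f(x)|\le\delta$ and $\ell_f(x,y)=\delta|y-f(x)|-\delta^2/2$ otherwise (the Huber loss). Let $F$ be a convex class of measurable functions $\mathcal X\to\mathbb R$ and let $f^*\in F$ be a minimizer over $F$ of the risk $R(f)=\mathbb E\,\ell_f(X,Y)$; put $\mathcal L_f=\ell_f-\ell_{f^*}$ and $P\mathcal L_f=\mathbb E\,\mathcal L_f(X,Y)$. If $Y$ is not integrable, minimality of $f^*$ is understood as $P\mathcal L_f\ge 0$ for all $f\in F$, that is, $\mathbb E[\mathcal L_f(X,Y)^-]\le\mathbb E[\mathcal L_f(X,Y)^+]$ in $[0,\infty]$. Assume that $\varepsilon>0$ and $C'>0$ are such that $\|f-f^*\|_{L_{2+\varepsilon}}\le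 C'\|f-f^*\|_{L_2}$ for all $f\in F$. Assume that $\alpha>0$ and $r>0$ are such that, for every $x\in\mathcal X$ and every $z\in\mathbb R$ with $|z-f^*(x)|\le(\sqrt2\,C')^{(2+\varepsilon)/\varepsilon}\,r$, \[F_{Y|X=x}(z+\delta)-F_{Y|X=x}(z-\delta)\ge\alpha .\] Then, for every $f\in F$ with $\|f-f^*\|_{L_2}\le r$, the excess loss $\mathcal L_f(X,Y)$ is integrable and \[\|f-f^*\|_{L_2}^2\le\frac4\alpha\,P\mathcal L_f .\] -/

import Mathlib

open MeasureTheory ProbabilityTheory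

noncomputable section

/-- The Huber function `ρ_H` with parameter `δ`. -/
def huber (δ t : ℝ) : ℝ :=
  if |t| ≤ δ then t ^ 2 / 2 else δ * |t| - δ ^ 2 / 2

/-- The Huber loss `ℓ_f(x, y) = ρ_H(y - f x)`. -/
def huberLoss {𝒳 : Type*} (δ : ℝ) (f : 𝒳 → ℝ) (p : 𝒳 × ℝ) : ℝ :=
  huber δ (p.2 - f p.1)

/-- The excess loss `ℓ_f - ℓ_g` of `f` relative to `g`. -/
def excessLoss {𝒳 : Type*} (δ : ℝ) (f g : 𝒳 → ℝ) (p : 𝒳 × ℝ) : ℝ :=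
  huberLoss δ f p - huberLoss δ g p

/-- The excess risk `P(ℓ_f - ℓ_g)`. -/
def excessRisk {𝒳 : Type*} [MeasurableSpace 𝒳] (P : Measure (𝒳 × ℝ)) (δ : ℝ)
    (f g : 𝒳 → ℝ) : ℝ :=
  ∫ p, excessLoss δ f g p ∂P

/-- `g` minimizes the Huber risk over `F`. The comparison of the risks of `f` and `g` is made
through `E (ℓ_f - ℓ_g) ≥ 0`, written as an inequality in `[0, ∞]` between the expectations of the
negative and the positive part. This makes sense even when `Y` is not integrable; it is
`0 ≤ excessRisk P δ f g` when the excess loss is integrable (see `nonneg_excessRisk_iff`), and it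
is `R g ≤ R f` in `[0, ∞]` when the risk `R g` is finite. -/
structure IsRiskMinimizer {𝒳 : Type*} [MeasurableSpace 𝒳] (P : Measure (𝒳 × ℝ)) (δ : ℝ)
    (F : Set (𝒳 → ℝ)) (g : 𝒳 → ℝ) : Prop where
  mem : g ∈ F
  le : ∀ f ∈ F, ∫⁻ p, ENNReal.ofReal (-excessLoss δ f g p) ∂P ≤
    ∫⁻ p, ENNReal.ofReal (excessLoss δ f g p) ∂P

theorem nonneg_excessRisk_iff {𝒳 : Type*} [MeasurableSpace 𝒳] (P : Measure (𝒳 × ℝ)) (δ : ℝ)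
    (f g : 𝒳 → ℝ) (h : Integrable (excessLoss δ f g) P) :
    0 ≤ excessRisk P δ f g ↔ ∫⁻ p, ENNReal.ofReal (-excessLoss δ f g p) ∂P ≤
      ∫⁻ p, ENNReal.ofReal (excessLoss δ f g p) ∂P := by
  unfold excessRisk
  rw [integral_eq_lintegral_pos_part_sub_lintegral_neg_part h, sub_nonneg]
  refine ENNReal.toReal_le_toReal ?_ ?_
  · have := h.neg.lintegral_lt_top
    exact this.ne
  · exact h.lintegral_lt_top.ne

/-- The risk in `[0, ∞]`: where the risk of `g` is finite, `IsRiskMinimizer` compares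
the risks themselves. -/
theorem lintegral_huberLoss_le_iff {𝒳 : Type*} [MeasurableSpace 𝒳] (P : Measure (𝒳 × ℝ)) (δ : ℝ)
    (hδ : 0 < δ) (f g : 𝒳 → ℝ) (hf : Measurable f) (hg : Measurable g)
    (h : ∫⁻ p, ENNReal.ofReal (huberLoss δ g p) ∂P ≠ ⊤) :
    ∫⁻ p, ENNReal.ofReal (huberLoss δ g p) ∂P ≤ ∫⁻ p, ENNReal.ofReal (huberLoss δ f p) ∂P ↔
      ∫⁻ p, ENNReal.ofReal (-excessLoss δ f g p) ∂P ≤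
        ∫⁻ p, ENNReal.ofReal (excessLoss δ f g p) ∂P := by
  have hm : Measurable (huber δ) := by
    unfold huber
    exact Measurable.ite (measurableSet_le (by fun_prop) (by fun_prop)) (by fun_prop) (by fun_prop)
  have hn : ∀ t, 0 ≤ huber δ t := fun t => by
    unfold huber
    split_ifs with ht
    · positivity
    · push Not at ht; nlinarith
  have hmf : Measurable (huberLoss δ f) := by unfold huberLoss; fun_prop
  have hmg : Measurable (huberLoss δ g) := by unfold huberLoss; fun_prop
  have hme : Measurable (excessLoss δ f g) := hmf.sub hmg
  have key : ∫⁻ p, ENNReal.ofReal (huberLoss δ f p) ∂P +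
      ∫⁻ p, ENNReal.ofReal (-excessLoss δ f g p) ∂P =
      ∫⁻ p, ENNReal.ofReal (huberLoss δ g p) ∂P +
      ∫⁻ p, ENNReal.ofReal (excessLoss δ f g p) ∂P := by
    rw [← lintegral_add_left hmf.ennreal_ofReal, ← lintegral_add_left hmg.ennreal_ofReal]
    refine lintegral_congr fun p => ?_
    have h1 : 0 ≤ huberLoss δ f p := hn _
    have h2 : 0 ≤ huberLoss δ g p := hn _
    unfold excessLoss
    rcases le_total (huberLoss δ f p) (huberLoss δ g p) with hle | hle
    · rw [ENNReal.ofReal_of_nonpos (p := huberLoss δ f p - huberLoss δ g p) (by linarith),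
        ← ENNReal.ofReal_add h1 (by linarith), add_zero]
      congr 1; ring
    · rw [ENNReal.ofReal_of_nonpos (p := -(huberLoss δ f p - huberLoss δ g p)) (by linarith),
        ← ENNReal.ofReal_add h2 (by linarith), add_zero]
      congr 1; ring
  have hneg : ∫⁻ p, ENNReal.ofReal (-excessLoss δ f g p) ∂P ≠ ⊤ := by
    refine ne_top_of_le_ne_top h (lintegral_mono fun p => ENNReal.ofReal_le_ofReal ?_)
    have h1 : 0 ≤ huberLoss δ f p := hn _
    unfold excessLoss; linarith
  constructor
  · intro hle
    have := add_le_add_left hle (∫⁻ p, ENNReal.ofReal (-excessLoss δ f g p) ∂P)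
    rw [key] at this
    exact (ENNReal.add_le_add_iff_left h).1 this
  · intro hle
    have := add_le_add_right hle (∫⁻ p, ENNReal.ofReal (huberLoss δ g p) ∂P)
    rw [← key] at this
    exact (ENNReal.add_le_add_iff_right hneg).1 this

end

/-- The derivative of the Huber function: the truncation of `t` to `[-δ, δ]`. -/
noncomputable def huberDeriv (δ t : ℝ) : ℝ := max (-δ) (min t δ)

/-- The remainder of the first-order expansion of the Huber function at `t`, with step `-u`. -/
noncomputable def huberRemainder (δ t u : ℝ) : ℝ := huber δ (t - u) - huber δ t + u * huberDeriv δ t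

theorem huber_of_le {δ t : ℝ} (hδ : 0 < δ) (h : t ≤ -δ) : huber δ t = -δ * t - δ ^ 2 / 2 := by
  unfold huber
  split_ifs with ht
  · have : t = -δ := le_antisymm h (abs_le.1 ht).1
    subst this; ring
  · rw [abs_of_neg (by linarith)]; ring

theorem huber_of_ge {δ t : ℝ} (hδ : 0 < δ) (h : δ ≤ t) : huber δ t = δ * t - δ ^ 2 / 2 := by
  unfold huber
  split_ifs with ht
  · have : t = δ := le_antisymm (abs_le.1 ht).2 h
    subst this; ring
  · rw [abs_of_pos (by linarith)]

theorem huber_of_mem {δ t : ℝ} (h : |t| ≤ δ) : huber δ t = t ^ 2 / 2 := if_pos h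

theorem huberDeriv_of_le {δ t : ℝ} (hδ : 0 < δ) (h : t ≤ -δ) : huberDeriv δ t = -δ := by
  unfold huberDeriv; rw [min_eq_left (by linarith), max_eq_left h]

theorem huberDeriv_of_ge {δ t : ℝ} (hδ : 0 < δ) (h : δ ≤ t) : huberDeriv δ t = δ := by
  unfold huberDeriv; rw [min_eq_right h, max_eq_right (by linarith)]

theorem huberDeriv_of_mem {δ t : ℝ} (h : |t| ≤ δ) : huberDeriv δ t = t := by
  obtain ⟨h1, h2⟩ := abs_le.1 h
  unfold huberDeriv; rw [min_eq_left h2, max_eq_right h1]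

theorem abs_huberDeriv_le {δ : ℝ} (hδ : 0 < δ) (t : ℝ) : |huberDeriv δ t| ≤ δ := by
  unfold huberDeriv
  exact abs_le.2 ⟨le_max_left _ _, max_le (by linarith) (min_le_right _ _)⟩

theorem continuous_huberDeriv (δ : ℝ) : Continuous (huberDeriv δ) := by
  unfold huberDeriv; fun_prop

theorem continuous_huber (δ : ℝ) : Continuous (huber δ) := by
  unfold huber
  refine Continuous.if_le (by fun_prop) (by fun_prop) (by fun_prop) (by fun_prop) fun t ht => ?_
  rw [← sq_abs, ht]; ring

theorem hasDerivAt_huber {δ t : ℝ} (hδ : 0 < δ) (ht : |t| ≠ δ) :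
    HasDerivAt (huber δ) (huberDeriv δ t) t := by
  rcases lt_or_gt_of_ne ht with h | h
  · rw [huberDeriv_of_mem h.le]
    have h0 : HasDerivAt (fun s : ℝ => s ^ 2 / 2) t t := by
      simpa using ((hasDerivAt_id t).pow 2).div_const 2
    refine h0.congr_of_eventuallyEq ?_
    filter_upwards [continuous_abs.continuousAt.eventually_lt continuousAt_const h] with s hs
    exact huber_of_mem hs.le
  · rcases lt_abs.1 h with h | h
    · rw [huberDeriv_of_ge hδ h.le]
      have h0 : HasDerivAt (fun s : ℝ => δ * s - δ ^ 2 / 2) δ t := by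
        simpa using ((hasDerivAt_id t).const_mul δ).sub_const (δ ^ 2 / 2)
      refine h0.congr_of_eventuallyEq ?_
      filter_upwards [lt_mem_nhds h] with s hs
      exact huber_of_ge hδ hs.le
    · have h' : t < -δ := by linarith
      rw [huberDeriv_of_le hδ h'.le]
      have h0 : HasDerivAt (fun s : ℝ => -δ * s - δ ^ 2 / 2) (-δ) t := by
        simpa using ((hasDerivAt_id t).const_mul (-δ)).sub_const (δ ^ 2 / 2)
      refine h0.congr_of_eventuallyEq ?_
      filter_upwards [gt_mem_nhds h'] with s hs
      exact huber_of_le hδ hs.le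

theorem hasDerivAt_huberDeriv {δ t : ℝ} (hδ : 0 < δ) (ht : |t| ≠ δ) :
    HasDerivAt (huberDeriv δ) ((Set.Ioc (-δ) δ).indicator 1 t) t := by
  rcases lt_or_gt_of_ne ht with h | h
  · have hm : t ∈ Set.Ioc (-δ) δ := ⟨(abs_lt.1 h).1, (abs_lt.1 h).2.le⟩
    rw [Set.indicator_of_mem hm]
    refine (hasDerivAt_id t).congr_of_eventuallyEq ?_
    filter_upwards [continuous_abs.continuousAt.eventually_lt continuousAt_const h] with s hs
    exact huberDeriv_of_mem hs.le
  · have hm : t ∉ Set.Ioc (-δ) δ := fun hm => by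
      have := abs_le.2 ⟨hm.1.le, hm.2⟩
      linarith
    rw [Set.indicator_of_notMem hm]
    rcases lt_abs.1 h with h | h
    · refine (hasDerivAt_const t δ).congr_of_eventuallyEq ?_
      filter_upwards [lt_mem_nhds h] with s hs
      exact huberDeriv_of_ge hδ hs.le
    · have h' : t < -δ := by linarith
      refine (hasDerivAt_const t (-δ)).congr_of_eventuallyEq ?_
      filter_upwards [gt_mem_nhds h'] with s hs
      exact huberDeriv_of_le hδ hs.le

theorem measurable_taylorKernel (δ u : ℝ) : Measurable fun q : ℝ × ℝ =>
    (1 - q.1) * u ^ 2 * (Set.Ioc (-δ) δ).indicator (1 : ℝ → ℝ) (q.2 - q.1 * u) := by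
  have : Measurable ((Set.Ioc (-δ) δ).indicator (1 : ℝ → ℝ)) :=
    measurable_one.indicator measurableSet_Ioc
  fun_prop

theorem taylorKernel_mem_Icc (δ u t : ℝ) {s : ℝ} (hs : s ∈ Set.Icc (0 : ℝ) 1) :
    (1 - s) * u ^ 2 * (Set.Ioc (-δ) δ).indicator (1 : ℝ → ℝ) (t - s * u) ∈
      Set.Icc 0 ((1 - s) * u ^ 2) := by
  have h0 : 0 ≤ (1 - s) * u ^ 2 := mul_nonneg (by linarith [hs.2]) (sq_nonneg u)
  by_cases hm : t - s * u ∈ Set.Ioc (-δ) δ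
  · simp [Set.indicator_of_mem hm, h0]
  · simp [Set.indicator_of_notMem hm, h0]

theorem intervalIntegrable_taylorKernel (δ t u : ℝ) : IntervalIntegrable (fun s : ℝ =>
    (1 - s) * u ^ 2 * (Set.Ioc (-δ) δ).indicator (1 : ℝ → ℝ) (t - s * u)) volume 0 1 := by
  refine IntervalIntegrable.mono_fun' (g := fun s => (1 - s) * u ^ 2)
    ((by fun_prop : Continuous fun s : ℝ => (1 - s) * u ^ 2).intervalIntegrable 0 1) ?_ ?_
  · exact ((measurable_taylorKernel δ u).comp
      (measurable_id.prodMk measurable_const)).aestronglyMeasurable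
  · refine (ae_restrict_iff' measurableSet_uIoc).2 (Filter.Eventually.of_forall fun s hs => ?_)
    rw [Set.uIoc_of_le zero_le_one] at hs
    have := taylorKernel_mem_Icc δ u t (Set.Ioc_subset_Icc_self hs)
    beta_reduce
    rw [Real.norm_of_nonneg this.1]
    exact this.2

theorem integral_one_sub_mul (c : ℝ) : ∫ s in (0 : ℝ)..1, (1 - s) * c = c / 2 := by
  rw [intervalIntegral.integral_mul_const]
  rw [intervalIntegral.integral_sub (by simp) (by simp)]
  simp; ring

/-- Taylor's formula with integral remainder for the Huber function. -/
theorem huberRemainder_eq_integral {δ : ℝ} (hδ : 0 < δ) (t u : ℝ) :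
    huberRemainder δ t u = ∫ s in (0 : ℝ)..1,
      (1 - s) * u ^ 2 * (Set.Ioc (-δ) δ).indicator (1 : ℝ → ℝ) (t - s * u) := by
  rcases eq_or_ne u 0 with rfl | hu
  · simp [huberRemainder]
  have hc := continuous_huber δ
  have hc' := continuous_huberDeriv δ
  have key := integral_eq_of_hasDerivAt_off_countable (a := (0 : ℝ)) (b := 1)
    (fun s => huber δ (t - s * u) - (1 - s) * u * huberDeriv δ (t - s * u))
    (fun s => (1 - s) * u ^ 2 * (Set.Ioc (-δ) δ).indicator (1 : ℝ → ℝ) (t - s * u))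
    (s := {(t - δ) / u, (t + δ) / u}) (Set.toFinite _).countable
    (by fun_prop) ?_ (intervalIntegrable_taylorKernel δ t u)
  · rw [key]; simp [huberRemainder]; ring
  · intro s hs
    have hne : |t - s * u| ≠ δ := by
      intro h
      apply hs.2
      rcases (abs_eq hδ.le).1 h with h | h
      · left; rw [eq_div_iff hu]; linarith
      · right; rw [Set.mem_singleton_iff, eq_div_iff hu]; linarith
    have hi : HasDerivAt (fun s : ℝ => t - s * u) (-u) s := by
      simpa using ((hasDerivAt_id s).mul_const u).const_sub t
    have h1 : HasDerivAt (fun s : ℝ => huber δ (t - s * u)) _ s :=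
      HasDerivAt.comp s (h₂ := huber δ) (hasDerivAt_huber hδ hne) hi
    have h2 : HasDerivAt (fun s : ℝ => huberDeriv δ (t - s * u)) _ s :=
      HasDerivAt.comp s (h₂ := huberDeriv δ) (hasDerivAt_huberDeriv hδ hne) hi
    have h3 : HasDerivAt (fun s : ℝ => (1 - s) * u) (-u) s := by
      simpa using ((hasDerivAt_id s).const_sub 1).mul_const u
    refine (h1.sub (h3.mul h2)).congr_deriv ?_
    ring

theorem huberRemainder_nonneg {δ : ℝ} (hδ : 0 < δ) (t u : ℝ) : 0 ≤ huberRemainder δ t u := by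
  rw [huberRemainder_eq_integral hδ]
  exact intervalIntegral.integral_nonneg zero_le_one fun s hs =>
    (taylorKernel_mem_Icc δ u t hs).1

theorem huberRemainder_le {δ : ℝ} (hδ : 0 < δ) (t u : ℝ) :
    huberRemainder δ t u ≤ u ^ 2 / 2 := by
  rw [huberRemainder_eq_integral hδ, ← integral_one_sub_mul]
  exact intervalIntegral.integral_mono_on zero_le_one (intervalIntegrable_taylorKernel δ t u)
    ((by fun_prop : Continuous fun s : ℝ => (1 - s) * u ^ 2).intervalIntegrable 0 1)
    fun s hs => (taylorKernel_mem_Icc δ u t hs).2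

/-- If `ν` gives mass at least `α` to `(z - δ, z + δ]` for each `z` between `a` and `a + u`, then
the expected remainder has curvature at least `α`. -/
theorem le_integral_huberRemainder {δ : ℝ} (hδ : 0 < δ) (ν : Measure ℝ) [IsProbabilityMeasure ν]
    {α a u : ℝ} (h : ∀ z, |z - a| ≤ |u| → α ≤ cdf ν (z + δ) - cdf ν (z - δ)) :
    α * u ^ 2 / 2 ≤ ∫ y, huberRemainder δ (y - a) u ∂ν := by
  have hmeas : Measurable fun q : ℝ × ℝ =>
      (1 - q.1) * u ^ 2 * (Set.Ioc (-δ) δ).indicator (1 : ℝ → ℝ) (q.2 - a - q.1 * u) :=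
    (measurable_taylorKernel δ u).comp
      (measurable_fst.prodMk (measurable_snd.sub_const a))
  have hint : Integrable (fun q : ℝ × ℝ =>
      (1 - q.1) * u ^ 2 * (Set.Ioc (-δ) δ).indicator (1 : ℝ → ℝ) (q.2 - a - q.1 * u))
      ((volume.restrict (Set.Ioc (0 : ℝ) 1)).prod ν) := by
    refine Integrable.of_bound hmeas.aestronglyMeasurable (u ^ 2) ?_
    have hae : ∀ᵐ q ∂((volume.restrict (Set.Ioc (0 : ℝ) 1)).prod ν), q.1 ∈ Set.Ioc (0 : ℝ) 1 :=
      Measure.quasiMeasurePreserving_fst.ae (ae_restrict_mem measurableSet_Ioc)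
    filter_upwards [hae] with q hq
    have := taylorKernel_mem_Icc δ u (q.2 - a) (Set.Ioc_subset_Icc_self hq)
    rw [Real.norm_of_nonneg this.1]
    refine this.2.trans ?_
    nlinarith [sq_nonneg u, hq.1]
  have hswap : ∫ y, huberRemainder δ (y - a) u ∂ν = ∫ s in (0 : ℝ)..1,
      (1 - s) * u ^ 2 * ∫ y, (Set.Ioc (-δ) δ).indicator (1 : ℝ → ℝ) (y - a - s * u) ∂ν := by
    simp_rw [huberRemainder_eq_integral hδ, intervalIntegral.integral_of_le zero_le_one,
      ← integral_const_mul]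
    exact (integral_integral_swap hint).symm
  have hmass : ∀ s ∈ Set.Icc (0 : ℝ) 1,
      α ≤ ∫ y, (Set.Ioc (-δ) δ).indicator (1 : ℝ → ℝ) (y - a - s * u) ∂ν := by
    intro s hs
    have hz := h (a + s * u) (by
      rw [add_sub_cancel_left, abs_mul, abs_of_nonneg hs.1]
      exact mul_le_of_le_one_left (abs_nonneg u) hs.2)
    have hset : (fun y => (Set.Ioc (-δ) δ).indicator (1 : ℝ → ℝ) (y - a - s * u)) =
        (Set.Ioc (a + s * u - δ) (a + s * u + δ)).indicator 1 := by
      funext y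
      simp only [Set.indicator_apply, Set.mem_Ioc]
      congr 1
      apply propext
      constructor <;> rintro ⟨h1, h2⟩ <;> constructor <;> linarith
    rw [hset, integral_indicator_one measurableSet_Ioc]
    refine hz.trans_eq ?_
    rw [cdf_eq_real, cdf_eq_real, ← measureReal_sdiff (Set.Iic_subset_Iic.2 (by linarith))
      measurableSet_Iic, Set.Iic_sdiff_Iic]
  rw [hswap, mul_div_assoc, mul_comm, ← mul_div_right_comm, ← integral_one_sub_mul]
  have hii : IntervalIntegrable (fun s : ℝ =>
      (1 - s) * u ^ 2 * ∫ y, (Set.Ioc (-δ) δ).indicator (1 : ℝ → ℝ) (y - a - s * u) ∂ν)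
      volume 0 1 := by
    rw [intervalIntegrable_iff_integrableOn_Ioc_of_le zero_le_one]
    simp_rw [← integral_const_mul]
    exact hint.integral_prod_left
  refine intervalIntegral.integral_mono_on zero_le_one
    ((by fun_prop : Continuous fun s : ℝ => (1 - s) * (u ^ 2 * α)).intervalIntegrable 0 1)
    hii fun s hs => ?_
  rw [← mul_assoc]
  exact mul_le_mul_of_nonneg_left (hmass s hs) (mul_nonneg (by linarith [hs.2]) (sq_nonneg u))

theorem toReal_eLpNorm_rpow {Ω : Type*} [MeasurableSpace Ω] {μ : Measure Ω} {h : Ω → ℝ} {q : ℝ}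
    (hq : 0 < q) (hh : MemLp h (ENNReal.ofReal q) μ) :
    (eLpNorm h (ENNReal.ofReal q) μ).toReal ^ q = ∫ x, |h x| ^ q ∂μ := by
  have h0 : 0 ≤ ∫ x, |h x| ^ q ∂μ := integral_nonneg fun x => by positivity
  rw [hh.eLpNorm_eq_integral_rpow_norm (by simpa using hq) ENNReal.ofReal_ne_top,
    ENNReal.toReal_ofReal hq.le]
  simp_rw [Real.norm_eq_abs]
  rw [ENNReal.toReal_ofReal (by positivity), Real.rpow_inv_rpow h0 hq.ne']

theorem toReal_eLpNorm_two_sq {Ω : Type*} [MeasurableSpace Ω] {μ : Measure Ω} {h : Ω → ℝ}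
    (hh : MemLp h 2 μ) : (eLpNorm h 2 μ).toReal ^ 2 = ∫ x, h x ^ 2 ∂μ := by
  have := toReal_eLpNorm_rpow (μ := μ) (h := h) two_pos (by simpa using hh)
  simpa using this

theorem rpow_mul_rpow_le_half_sq {ε C r σ : ℝ} (hε : 0 < ε) (hC : 0 < C) (hr : 0 < r)
    (hσ : 0 ≤ σ) (hσr : σ ≤ r) :
    ((Real.sqrt 2 * C) ^ ((2 + ε) / ε) * r) ^ (-ε) * (C * σ) ^ (2 + ε) ≤ σ ^ 2 / 2 := by
  have h2 : 0 < Real.sqrt 2 := by positivity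
  have hK : ((Real.sqrt 2 * C) ^ ((2 + ε) / ε) * r) ^ (-ε) =
      ((Real.sqrt 2) ^ (2 + ε) * C ^ (2 + ε) * r ^ ε)⁻¹ := by
    rw [Real.rpow_neg (by positivity), Real.mul_rpow (by positivity) hr.le,
      ← Real.rpow_mul (by positivity), div_mul_cancel₀ _ hε.ne', Real.mul_rpow h2.le hC.le]
  have hs : (2 : ℝ) ≤ (Real.sqrt 2) ^ (2 + ε) := by
    rw [Real.rpow_add h2, Real.rpow_two, Real.sq_sqrt zero_le_two]
    have : 1 ≤ (Real.sqrt 2) ^ ε :=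
      Real.one_le_rpow (Real.one_le_sqrt.2 one_le_two) hε.le
    linarith
  have hσε : σ ^ (2 + ε) = σ ^ 2 * σ ^ ε := by
    rw [Real.rpow_add_of_nonneg hσ zero_le_two hε.le, Real.rpow_two]
  have hσrε : σ ^ ε ≤ r ^ ε := Real.rpow_le_rpow hσ hσr hε.le
  have hrε : 0 < r ^ ε := Real.rpow_pos_of_pos hr ε
  have hCε : 0 < C ^ (2 + ε) := Real.rpow_pos_of_pos hC _
  rw [hK, Real.mul_rpow hC.le hσ, hσε, inv_mul_le_iff₀ (by positivity)]
  calc C ^ (2 + ε) * (σ ^ 2 * σ ^ ε) ≤ C ^ (2 + ε) * (σ ^ 2 * r ^ ε) := by gcongr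
    _ = 2 * C ^ (2 + ε) * r ^ ε * (σ ^ 2 / 2) := by ring
    _ ≤ _ := by gcongr

/-- Under the equivalence of the `L_{2+ε}` and `L₂` norms, at least half of the second moment is
carried by the values of modulus at most `(√2 C)^{(2+ε)/ε} r`. -/
theorem half_sq_le_integral_truncated_sq {Ω : Type*} [MeasurableSpace Ω] {μ : Measure Ω}
    {h : Ω → ℝ} (hm : Measurable h) {ε C r : ℝ} (hε : 0 < ε) (hC : 0 < C) (hr : 0 < r)
    (hequiv : eLpNorm h (ENNReal.ofReal (2 + ε)) μ ≤ ENNReal.ofReal C * eLpNorm h 2 μ)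
    (hle : eLpNorm h 2 μ ≤ ENNReal.ofReal r) :
    (∫ x, h x ^ 2 ∂μ) / 2 ≤
      ∫ x, {x | |h x| ≤ (Real.sqrt 2 * C) ^ ((2 + ε) / ε) * r}.indicator (fun x => h x ^ 2) x
        ∂μ := by
  set M : ℝ := (Real.sqrt 2 * C) ^ ((2 + ε) / ε) * r with hMdef
  have hM : 0 < M := by positivity
  have hq : 0 < 2 + ε := by linarith
  have hL2 : MemLp h 2 μ := ⟨hm.aestronglyMeasurable, hle.trans_lt ENNReal.ofReal_lt_top⟩
  have hLq : MemLp h (ENNReal.ofReal (2 + ε)) μ := ⟨hm.aestronglyMeasurable,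
    hequiv.trans_lt (ENNReal.mul_lt_top ENNReal.ofReal_lt_top hL2.2)⟩
  have hi2 : Integrable (fun x => h x ^ 2) μ := hL2.integrable_sq
  have hiq : Integrable (fun x => |h x| ^ (2 + ε)) μ := by
    have := hLq.integrable_norm_rpow (by simpa using hq) ENNReal.ofReal_ne_top
    simpa [ENNReal.toReal_ofReal hq.le] using this
  have hS : MeasurableSet {x | |h x| ≤ M} := measurableSet_le (by fun_prop) measurable_const
  have hiS := hi2.indicator hS
  have hpt : ∀ x, h x ^ 2 ≤ {x | |h x| ≤ M}.indicator (fun x => h x ^ 2) x +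
      M ^ (-ε) * |h x| ^ (2 + ε) := by
    intro x
    by_cases hx : |h x| ≤ M
    · rw [Set.indicator_of_mem (by exact hx)]
      have : 0 ≤ M ^ (-ε) * |h x| ^ (2 + ε) := by positivity
      linarith
    · rw [Set.indicator_of_notMem (by exact hx), zero_add, Real.rpow_neg hM.le,
        le_inv_mul_iff₀ (by positivity), Real.rpow_add_of_nonneg (abs_nonneg _) zero_le_two hε.le,
        Real.rpow_two, sq_abs, mul_comm]
      have := Real.rpow_le_rpow hM.le (not_le.1 hx).le hε.le
      gcongr
  have hint : ∫ x, h x ^ 2 ∂μ ≤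
      (∫ x, {x | |h x| ≤ M}.indicator (fun x => h x ^ 2) x ∂μ) +
        M ^ (-ε) * ∫ x, |h x| ^ (2 + ε) ∂μ := by
    rw [← integral_const_mul, ← integral_add hiS (hiq.const_mul _)]
    exact integral_mono hi2 (hiS.add (hiq.const_mul _)) hpt
  have hnorm : (eLpNorm h (ENNReal.ofReal (2 + ε)) μ).toReal ≤ C * (eLpNorm h 2 μ).toReal := by
    have := ENNReal.toReal_mono (ENNReal.mul_ne_top ENNReal.ofReal_ne_top hL2.2.ne) hequiv
    rwa [ENNReal.toReal_mul, ENNReal.toReal_ofReal hC.le] at this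
  have hσr : (eLpNorm h 2 μ).toReal ≤ r := by
    simpa [ENNReal.toReal_ofReal hr.le] using ENNReal.toReal_mono ENNReal.ofReal_ne_top hle
  have htail : M ^ (-ε) * ∫ x, |h x| ^ (2 + ε) ∂μ ≤ (∫ x, h x ^ 2 ∂μ) / 2 := by
    rw [← toReal_eLpNorm_rpow hq hLq, ← toReal_eLpNorm_two_sq hL2]
    refine le_trans ?_ (rpow_mul_rpow_le_half_sq hε hC hr ENNReal.toReal_nonneg hσr)
    exact mul_le_mul_of_nonneg_left (Real.rpow_le_rpow ENNReal.toReal_nonneg hnorm hq.le)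
      (by positivity)
  linarith

theorem measurable_huberRemainder {δ : ℝ} {Ω : Type*} [MeasurableSpace Ω] {t u : Ω → ℝ}
    (ht : Measurable t) (hu : Measurable u) :
    Measurable fun p => huberRemainder δ (t p) (u p) := by
  have h1 := (continuous_huber δ).measurable
  have h2 := (continuous_huberDeriv δ).measurable
  unfold huberRemainder
  fun_prop

theorem integrable_huberRemainder {δ : ℝ} (hδ : 0 < δ) {Ω : Type*} [MeasurableSpace Ω]
    {μ : Measure Ω} {t u : Ω → ℝ} (ht : Measurable t) (hu : Measurable u) (hL2 : MemLp u 2 μ) :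
    Integrable (fun p => huberRemainder δ (t p) (u p)) μ := by
  refine (hL2.integrable_sq.div_const 2).mono'
    (measurable_huberRemainder ht hu).aestronglyMeasurable (Filter.Eventually.of_forall fun p => ?_)
  rw [Real.norm_of_nonneg (huberRemainder_nonneg hδ _ _)]
  exact huberRemainder_le hδ _ _

theorem integrable_mul_huberDeriv {δ : ℝ} (hδ : 0 < δ) {Ω : Type*} [MeasurableSpace Ω]
    {μ : Measure Ω} {t u : Ω → ℝ} (ht : Measurable t) (hu : Integrable u μ) :
    Integrable (fun p => u p * huberDeriv δ (t p)) μ :=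
  hu.mul_bdd (c := δ) ((continuous_huberDeriv δ).measurable.comp ht).aestronglyMeasurable
    (Filter.Eventually.of_forall fun p => abs_huberDeriv_le hδ (t p))

theorem excessLoss_eq {𝒳 : Type*} (δ : ℝ) (f g : 𝒳 → ℝ) (p : 𝒳 × ℝ) :
    excessLoss δ f g p = huberRemainder δ (p.2 - g p.1) ((f - g) p.1) -
      (f - g) p.1 * huberDeriv δ (p.2 - g p.1) := by
  unfold excessLoss huberLoss huberRemainder
  rw [Pi.sub_apply, show p.2 - g p.1 - (f p.1 - g p.1) = p.2 - f p.1 by ring]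
  ring

section Risk

variable {𝒳 : Type*} [MeasurableSpace 𝒳] {P : Measure (𝒳 × ℝ)} {δ : ℝ} {f g : 𝒳 → ℝ}

theorem memLp_comp_fst {h : 𝒳 → ℝ} (hh : MemLp h 2 P.fst) :
    MemLp (fun p : 𝒳 × ℝ => h p.1) 2 P :=
  hh.comp_measurePreserving ⟨measurable_fst, rfl⟩

theorem integrable_excessLoss [IsFiniteMeasure P] (hδ : 0 < δ) (hf : Measurable f)
    (hg : Measurable g) (hL2 : MemLp (f - g) 2 P.fst) : Integrable (excessLoss δ f g) P := by
  have ht : Measurable fun p : 𝒳 × ℝ => p.2 - g p.1 := by fun_prop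
  have hu : Measurable fun p : 𝒳 × ℝ => (f - g) p.1 := (hf.sub hg).comp measurable_fst
  have hL := memLp_comp_fst hL2
  rw [show excessLoss δ f g = _ from funext (excessLoss_eq δ f g)]
  exact (integrable_huberRemainder hδ ht hu hL).sub
    (integrable_mul_huberDeriv hδ ht (hL.integrable one_le_two))

theorem excessRisk_eq [IsFiniteMeasure P] (hδ : 0 < δ) (hf : Measurable f)
    (hg : Measurable g) (hL2 : MemLp (f - g) 2 P.fst) :
    excessRisk P δ f g = ∫ p, huberRemainder δ (p.2 - g p.1) ((f - g) p.1) ∂P -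
      ∫ p, (f - g) p.1 * huberDeriv δ (p.2 - g p.1) ∂P := by
  have ht : Measurable fun p : 𝒳 × ℝ => p.2 - g p.1 := by fun_prop
  have hu : Measurable fun p : 𝒳 × ℝ => (f - g) p.1 := (hf.sub hg).comp measurable_fst
  have hL := memLp_comp_fst hL2
  rw [← integral_sub (integrable_huberRemainder hδ ht hu hL)
    (integrable_mul_huberDeriv hδ ht (hL.integrable one_le_two))]
  exact integral_congr_ae (Filter.Eventually.of_forall (excessLoss_eq δ f g))

/-- First-order optimality of a risk minimizer over a convex class. -/
theorem IsRiskMinimizer.integral_mul_huberDeriv_nonpos [IsFiniteMeasure P] (hδ : 0 < δ)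
    {F : Set (𝒳 → ℝ)} (hF : Convex ℝ F) (hmin : IsRiskMinimizer P δ F g) (hfF : f ∈ F)
    (hf : Measurable f) (hg : Measurable g) (hL2 : MemLp (f - g) 2 P.fst) :
    ∫ p, (f - g) p.1 * huberDeriv δ (p.2 - g p.1) ∂P ≤ 0 := by
  set I := ∫ p, (f - g) p.1 * huberDeriv δ (p.2 - g p.1) ∂P with hI
  set A := ∫ p : 𝒳 × ℝ, (f - g) p.1 ^ 2 ∂P with hA
  have hA0 : 0 ≤ A := integral_nonneg fun p => sq_nonneg _
  have key : ∀ s ∈ Set.Ioc (0 : ℝ) 1, I ≤ s * (A / 2) := by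
    intro s hs
    have hfs : g + s • (f - g) ∈ F := hF.add_smul_sub_mem hmin.mem hfF ⟨hs.1.le, hs.2⟩
    have hsub : g + s • (f - g) - g = s • (f - g) := add_sub_cancel_left _ _
    have hms : Measurable (g + s • (f - g)) := hg.add ((hf.sub hg).const_smul s)
    have hLs : MemLp (g + s • (f - g) - g) 2 P.fst := by rw [hsub]; exact hL2.const_smul s
    have h0 := (nonneg_excessRisk_iff P δ _ g (integrable_excessLoss hδ hms hg hLs)).2
      (hmin.le _ hfs)
    rw [excessRisk_eq hδ hms hg hLs] at h0
    have ht : Measurable fun p : 𝒳 × ℝ => p.2 - g p.1 := by fun_prop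
    have hD : ∫ p, huberRemainder δ (p.2 - g p.1) ((g + s • (f - g) - g) p.1) ∂P ≤
        s ^ 2 * (A / 2) := by
      have hLs' := memLp_comp_fst hLs
      calc _ ≤ ∫ p : 𝒳 × ℝ, (g + s • (f - g) - g) p.1 ^ 2 / 2 ∂P :=
            integral_mono
              (integrable_huberRemainder hδ ht ((hms.sub hg).comp measurable_fst) hLs')
              (hLs'.integrable_sq.div_const 2) fun p => huberRemainder_le hδ _ _
        _ = s ^ 2 * (A / 2) := by
            rw [hsub, integral_div, ← mul_div_assoc, hA, ← integral_const_mul]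
            simp [mul_pow]
    have hIs : ∫ p, (g + s • (f - g) - g) p.1 * huberDeriv δ (p.2 - g p.1) ∂P = s * I := by
      rw [hsub, hI, ← integral_const_mul]
      simp [mul_assoc]
    rw [hIs] at h0
    refine le_of_mul_le_mul_left (a := s) ?_ hs.1
    calc s * I ≤ s ^ 2 * (A / 2) := by linarith
      _ = s * (s * (A / 2)) := by ring
  by_contra! hpos
  have h1 := key (min 1 (I / (A + 1))) ⟨lt_min one_pos (by positivity), min_le_left _ _⟩
  have h2 : min 1 (I / (A + 1)) * (A / 2) ≤ I / (A + 1) * (A / 2) := by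
    gcongr; exact min_le_right _ _
  have h3 : I / (A + 1) * (A / 2) < I := by
    rw [div_mul_eq_mul_div, div_lt_iff₀ (by positivity)]
    nlinarith
  linarith

end Risk

/-- Local Bernstein condition for the Huber loss. `P` is the law of `(X, Y)`, `P.fst` the law of
`X`, and `κ` a regular conditional distribution of `Y` given `X`. -/
theorem huber_loss_local_bernstein
    {𝒳 : Type*} [MeasurableSpace 𝒳]
    (P : Measure (𝒳 × ℝ)) [IsProbabilityMeasure P]
    (κ : Kernel 𝒳 ℝ) [IsMarkovKernel κ] [P.IsCondKernel κ]
    (δ : ℝ) (hδ : 0 < δ)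
    (F : Set (𝒳 → ℝ)) (hFmeas : ∀ f ∈ F, Measurable f) (hFconv : Convex ℝ F)
    (fstar : 𝒳 → ℝ) (hfstar : IsRiskMinimizer P δ F fstar)
    (ε : ℝ) (hε : 0 < ε) (C' : ℝ) (hC' : 0 < C')
    -- norm equivalence; `eLpNorm` takes values in `[0, ∞]`
    (hequiv : ∀ f ∈ F, eLpNorm (f - fstar) (ENNReal.ofReal (2 + ε)) P.fst ≤
      ENNReal.ofReal C' * eLpNorm (f - fstar) 2 P.fst)
    (α r : ℝ) (hα : 0 < α) (hr : 0 < r)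
    (hcdf : ∀ (x : 𝒳) (z : ℝ), |z - fstar x| ≤ (Real.sqrt 2 * C') ^ ((2 + ε) / ε) * r →
      α ≤ cdf (κ x) (z + δ) - cdf (κ x) (z - δ)) :
    ∀ f ∈ F, eLpNorm (f - fstar) 2 P.fst ≤ ENNReal.ofReal r →
      Integrable (excessLoss δ f fstar) P ∧
        (eLpNorm (f - fstar) 2 P.fst).toReal ^ 2 ≤ 4 / α * excessRisk P δ f fstar := by
  intro f hf hle
  have hmf := hFmeas f hf
  have hmg := hFmeas fstar hfstar.mem
  have hm : Measurable (f - fstar) := hmf.sub hmg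
  have hL2 : MemLp (f - fstar) 2 P.fst :=
    ⟨hm.aestronglyMeasurable, hle.trans_lt ENNReal.ofReal_lt_top⟩
  refine ⟨integrable_excessLoss hδ hmf hmg hL2, ?_⟩
  have hfirst := hfstar.integral_mul_huberDeriv_nonpos hδ hFconv hf hmf hmg hL2
  have hhalf := half_sq_le_integral_truncated_sq hm hε hC' hr (hequiv f hf) hle
  have hD : Integrable
      (fun p : 𝒳 × ℝ => huberRemainder δ (p.2 - fstar p.1) ((f - fstar) p.1)) P :=
    integrable_huberRemainder hδ (by fun_prop) (hm.comp measurable_fst) (memLp_comp_fst hL2)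
  have hD' := hD
  rw [← P.disintegrate κ] at hD'
  have hcomp : ∫ p, huberRemainder δ (p.2 - fstar p.1) ((f - fstar) p.1) ∂P =
      ∫ x, ∫ y, huberRemainder δ (y - fstar x) ((f - fstar) x) ∂κ x ∂P.fst := by
    rw [← Measure.integral_compProd hD', P.disintegrate κ]
  have hDi : Integrable (fun x => ∫ y, huberRemainder δ (y - fstar x) ((f - fstar) x) ∂κ x)
      P.fst := by
    have := ((Measure.integrable_compProd_iff hD'.aestronglyMeasurable).1 hD').2
    simpa only [Real.norm_of_nonneg (huberRemainder_nonneg hδ _ _)] using this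
  have hS : MeasurableSet
      {x | |(f - fstar) x| ≤ (Real.sqrt 2 * C') ^ ((2 + ε) / ε) * r} :=
    measurableSet_le (by fun_prop) measurable_const
  have hlower := integral_mono ((hL2.integrable_sq.indicator hS).const_mul (α / 2)) hDi fun x => by
    by_cases hx : |(f - fstar) x| ≤ (Real.sqrt 2 * C') ^ ((2 + ε) / ε) * r
    · beta_reduce
      rw [Set.indicator_of_mem (by exact hx), div_mul_eq_mul_div]
      exact le_integral_huberRemainder hδ (κ x) fun z hz => hcdf x z (hz.trans hx)
    · beta_reduce
      rw [Set.indicator_of_notMem (by exact hx), mul_zero]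
      exact integral_nonneg fun y => huberRemainder_nonneg hδ _ _
  rw [integral_const_mul, ← hcomp] at hlower
  rw [toReal_eLpNorm_two_sq hL2, excessRisk_eq hδ hmf hmg hL2, div_mul_eq_mul_div,
    le_div_iff₀ hα]
  have := mul_le_mul_of_nonneg_left hhalf (by positivity : 0 ≤ α / 2)
  linarith
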